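/- Let n ≥ 3, c > 0 and φ ≥ 0. Let M ∈ Sym₀(ℝ^n) be the tridiagonal matrix with M_{i,i+1} = M_{i+1,i} = φ/c for i = 1,…,n−1 and all other entries zero. Then T(M) = 2φ/c; moreover, for n > 4 there exists a feasible decomposition λ of M with Σ_m λ(m) = 2φ/c having at most 2n nonzero values. -/

import Mathlib

/-- The sign `m = (−1)^b` of a bit: encodings `m ∈ {−1,+1}^n` are represented by
boolean vectors `b : Fin n → Bool` via `m i = sgn (b i)`. -/
def sgn (b : Bool) : ℝ := if b then -1 else 1

/-- `lam` is a feasible decomposition of `M ∈ Sym₀(ℝ^n)`: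
`lam ≥ 0` and `M i j = Σ_{m ∈ {−1,+1}^n} lam m * m_i * m_j` for all `i ≠ j`. -/
def IsDecomp {n : ℕ} (M : Matrix (Fin n) (Fin n) ℝ)
    (lam : (Fin n → Bool) → ℝ) : Prop :=
  (∀ m, 0 ≤ lam m) ∧
  ∀ i j : Fin n, i ≠ j →
    M i j = ∑ m : Fin n → Bool, lam m * sgn (m i) * sgn (m j)

/-- The optimal gate time `T(M)`: infimum of `Σ_m lam m` over feasible decompositions. -/
noncomputable def gateTime {n : ℕ} (M : Matrix (Fin n) (Fin n) ℝ) : ℝ :=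
  sInf { t | ∃ lam, IsDecomp M lam ∧ ∑ m : Fin n → Bool, lam m = t }

lemma sgn_mul_self (b : Bool) : sgn b * sgn b = 1 := by
  cases b <;> norm_num [sgn]

lemma one_add_sgn_mul_sgn_of_ne {a b : Bool} (h : a ≠ b) : 1 + sgn a * sgn b = 0 := by
  cases a <;> cases b <;> simp_all [sgn]

/-- Frustration inequality for three spins. -/
lemma sgn_frustration (a b c : Bool) :
    sgn a * sgn b + sgn b * sgn c - sgn a * sgn c ≤ 1 := by
  cases a <;> cases b <;> cases c <;> norm_num [sgn]

/-- The entries of the Walsh–Hadamard matrix, with rows indexed by finite sets of bit positions. -/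
def walsh (S : Finset ℕ) (a : ℕ) : Bool := decide (Odd (S.filter fun k => a.testBit k).card)

lemma sgn_walsh (S : Finset ℕ) (a : ℕ) : sgn (walsh S a) = ∏ k ∈ S, sgn (a.testBit k) := by
  have h : ∏ k ∈ S, sgn (a.testBit k) = (-1) ^ (S.filter fun k => a.testBit k).card := by
    simp only [sgn, ← Finset.prod_filter, Finset.prod_const]
  rw [h]
  by_cases hodd : Odd (S.filter fun k => a.testBit k).card
  · simp [walsh, sgn, hodd, hodd.neg_one_pow]
  · simp [walsh, sgn, hodd, (Nat.not_odd_iff_even.mp hodd).neg_one_pow]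

/-- Orthogonality of the columns of the Walsh–Hadamard matrix of order `2 ^ L`. -/
lemma sum_walsh_mul_walsh {L a b : ℕ} (ha : a < 2 ^ L) (hb : b < 2 ^ L) :
    ∑ S ∈ (Finset.range L).powerset, sgn (walsh S a) * sgn (walsh S b) =
      if a = b then (2 : ℝ) ^ L else 0 := by
  simp only [sgn_walsh, ← Finset.prod_mul_distrib]
  rw [← Finset.prod_one_add]
  split_ifs with h
  · subst h
    simp only [sgn_mul_self, Finset.prod_const, Finset.card_range]
    norm_num
  · obtain ⟨k, hk⟩ : ∃ k, a.testBit k ≠ b.testBit k := by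
      by_contra! hall
      exact h (Nat.eq_of_testBit_eq hall)
    have hkL : k < L := by
      by_contra! hLk
      have hpow : 2 ^ L ≤ 2 ^ k := Nat.pow_le_pow_right two_pos hLk
      exact hk (by rw [Nat.testBit_lt_two_pow (ha.trans_le hpow),
        Nat.testBit_lt_two_pow (hb.trans_le hpow)])
    exact Finset.prod_eq_zero (Finset.mem_range.mpr hkL) (one_add_sgn_mul_sgn_of_ne hk)

/-- The weight function putting mass `q` on each member of a finite family of points. -/
noncomputable def familyWeight {ι α : Type*} [DecidableEq α] (s : Finset ι) (f : ι → α) (q : ℝ)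
    (m : α) : ℝ :=
  ∑ t ∈ s, if f t = m then q else 0

section familyWeight

variable {ι α : Type*} [DecidableEq α] (s : Finset ι) (f : ι → α) (q : ℝ)

lemma familyWeight_nonneg (hq : 0 ≤ q) (m : α) : 0 ≤ familyWeight s f q m :=
  Finset.sum_nonneg fun _ _ => by split_ifs <;> simp [hq]

lemma sum_familyWeight_mul [Fintype α] (g : α → ℝ) :
    ∑ m, familyWeight s f q m * g m = q * ∑ t ∈ s, g (f t) := by
  simp only [familyWeight, Finset.sum_mul, ite_mul, zero_mul]
  rw [Finset.sum_comm, Finset.mul_sum]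
  simp

lemma sum_familyWeight [Fintype α] : ∑ m, familyWeight s f q m = q * s.card := by
  simpa using sum_familyWeight_mul s f q fun _ => 1

lemma ncard_support_familyWeight_le : {m | familyWeight s f q m ≠ 0}.ncard ≤ s.card := by
  refine (Set.ncard_le_ncard (t := ↑(s.image f)) ?_ (Finset.finite_toSet _)).trans ?_
  · intro m hm
    obtain ⟨t, ht, hne⟩ := Finset.exists_ne_zero_of_sum_ne_zero hm
    exact Finset.mem_coe.mpr
      (Finset.mem_image.mpr ⟨t, ht, by by_contra h; exact hne (if_neg h)⟩)
  · rw [Set.ncard_coe_finset]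
    exact Finset.card_image_le

end familyWeight

/-- Pair up neighbouring sites, starting at an even (`p = 0`) or odd (`p = 1`) site, and give each
pair its own column of the Walsh–Hadamard matrix; the row is `S`. -/
def pairedWalsh (n : ℕ) (t : ℕ × Finset ℕ) (i : Fin n) : Bool := walsh t.2 ((i + t.1) / 2)

lemma sum_pairedWalsh {n L : ℕ} (hL : n < 2 ^ (L + 1)) {i j : Fin n} (hij : i ≠ j) :
    ∑ t ∈ Finset.range 2 ×ˢ (Finset.range L).powerset,
        sgn (pairedWalsh n t i) * sgn (pairedWalsh n t j) =
      if (i : ℕ) + 1 = j ∨ (j : ℕ) + 1 = i then (2 : ℝ) ^ L else 0 := by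
  have hi := i.isLt
  have hj := j.isLt
  have hne : (i : ℕ) ≠ j := fun h => hij (Fin.ext h)
  rw [pow_succ] at hL
  rw [Finset.sum_product, Finset.sum_range_succ, Finset.sum_range_one]
  simp only [pairedWalsh]
  rw [sum_walsh_mul_walsh (by omega) (by omega), sum_walsh_mul_walsh (by omega) (by omega)]
  split_ifs <;> first | omega | simp

lemma exists_isDecomp_of_tridiagonal {n : ℕ} (hn : n ≠ 0) {w : ℝ} (hw : 0 ≤ w)
    (M : Matrix (Fin n) (Fin n) ℝ)
    (hM : ∀ a b : Fin n, M a b =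
      if (a : ℕ) + 1 = (b : ℕ) ∨ (b : ℕ) + 1 = (a : ℕ) then w else 0) :
    ∃ lam : (Fin n → Bool) → ℝ, IsDecomp M lam ∧ {m | lam m ≠ 0}.ncard ≤ 2 * n ∧
      ∑ m : Fin n → Bool, lam m = 2 * w := by
  set L := Nat.log 2 n
  have hcard : (Finset.range 2 ×ˢ (Finset.range L).powerset).card = 2 * 2 ^ L := by simp
  refine ⟨familyWeight (Finset.range 2 ×ˢ (Finset.range L).powerset) (pairedWalsh n) (w / 2 ^ L),
    ⟨familyWeight_nonneg _ _ _ (by positivity), fun i j hij => ?_⟩, ?_, ?_⟩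
  · simp only [mul_assoc]
    rw [sum_familyWeight_mul _ _ _ fun m : Fin n → Bool => sgn (m i) * sgn (m j),
      sum_pairedWalsh (Nat.lt_pow_succ_log_self one_lt_two n) hij, hM]
    split_ifs
    · exact (div_mul_cancel₀ w (by positivity)).symm
    · simp
  · refine (ncard_support_familyWeight_le _ _ _).trans (hcard.trans_le ?_)
    exact Nat.mul_le_mul_left 2 (Nat.pow_log_le_self 2 hn)
  · rw [sum_familyWeight, hcard]
    push_cast
    field_simp

/-- Every decomposition has total weight bounded below by the frustration of any three sites. -/
lemma IsDecomp.le_sum {n : ℕ} {M : Matrix (Fin n) (Fin n) ℝ} {lam : (Fin n → Bool) → ℝ}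
    (h : IsDecomp M lam) {i j k : Fin n} (hij : i ≠ j) (hjk : j ≠ k) (hik : i ≠ k) :
    M i j + M j k - M i k ≤ ∑ m, lam m := by
  rw [h.2 i j hij, h.2 j k hjk, h.2 i k hik, ← Finset.sum_add_distrib, ← Finset.sum_sub_distrib]
  refine Finset.sum_le_sum fun m _ => ?_
  have := mul_le_mul_of_nonneg_left (sgn_frustration (m i) (m j) (m k)) (h.1 m)
  linarith

/-- for the tridiagonal `M ∈ Sym₀(ℝ^n)` with `M_{i,i+1} = M_{i+1,i} = φ/c`
and zeros elsewhere (`n ≥ 3`, `c > 0`, `φ ≥ 0`), the optimal gate time is `T(M) = 2φ/c`;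
moreover for `n > 4` there is a feasible decomposition with total `2φ/c` and at most `2n`
nonzero values. -/
theorem stmt_5 {n : ℕ} (hn : 3 ≤ n) (c φ : ℝ) (hc : 0 < c) (hφ : 0 ≤ φ)
    (M : Matrix (Fin n) (Fin n) ℝ)
    (hM : ∀ a b : Fin n, M a b =
      if (a : ℕ) + 1 = (b : ℕ) ∨ (b : ℕ) + 1 = (a : ℕ) then φ / c else 0) :
    gateTime M = 2 * φ / c ∧
    (4 < n → ∃ lam : (Fin n → Bool) → ℝ, IsDecomp M lam ∧
      {m | lam m ≠ 0}.ncard ≤ 2 * n ∧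
      ∑ m : Fin n → Bool, lam m = 2 * φ / c) := by
  have hex := exists_isDecomp_of_tridiagonal (by omega) (div_nonneg hφ hc.le) M hM
  simp only [← mul_div_assoc] at hex
  refine ⟨IsLeast.csInf_eq ⟨?_, ?_⟩, fun _ => hex⟩
  · obtain ⟨lam, hlam, -, hsum⟩ := hex
    exact ⟨lam, hlam, hsum⟩
  · rintro t ⟨lam, hlam, rfl⟩
    have h := hlam.le_sum (i := ⟨0, by omega⟩) (j := ⟨1, by omega⟩) (k := ⟨2, by omega⟩)
      (by simp) (by simp) (by simp)
    simp only [hM] at h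
    norm_num at h
    rw [mul_div_assoc]
    linarith
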